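/- Let d ≥ 1 and let V : ℤ^d → ℝ satisfy ‖V‖_∞ ≤ V_∞ < ∞. There exist constants C > 0 and L₀ > 0, depending only on d and V_∞, with the following property: for every 0 < ε ≤ 1/2, every E ∈ ℝ, every x₀ ∈ ℤ^d, and every L ≥ L₀ · log(1/ε), the number of eigenvalues (counted with multiplicity, i.e. the sum over μ ∈ [E, E+ε] of the dimension of the eigenspace of H_Λ for the eigenvalue μ) of the finite-volume operator H_Λ on Λ = Λ_L(x₀) lying in the interval [E, E+ε] is at most C · |Λ| / log(1/ε). -/

import Mathlib

noncomputable section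

/-- The discrete box `Λ_L(x₀) = {y ∈ ℤ^d : ‖y - x₀‖_∞ ≤ L/2}`, as a finite set.
(For an integer `k` one has `|k| ≤ L/2 ↔ |k| ≤ ⌊L/2⌋`.) -/
def boxZ (d : ℕ) (x₀ : Fin d → ℤ) (L : ℝ) : Finset (Fin d → ℤ) :=
  Fintype.piFinset fun i => Finset.Icc (x₀ i - ⌊L / 2⌋) (x₀ i + ⌊L / 2⌋)

/-- The matrix of the finite-volume discrete Schrödinger operator `H_Λ = -Δ_Λ + V` with
Dirichlet (simple) boundary condition:
`(H_Λ ψ)(x) = -∑_{y ∈ Λ, ‖x-y‖₁ = 1} ψ(y) + V(x) ψ(x)` for `x ∈ Λ`. -/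
def hamMat (d : ℕ) (V : (Fin d → ℤ) → ℝ) (Λ : Finset (Fin d → ℤ)) :
    Matrix ↥Λ ↥Λ ℂ := fun x y =>
  (if (∑ i, |x.1 i - y.1 i|) = 1 then -1 else 0) + (if x = y then (V x.1 : ℂ) else 0)

/-- The finite-volume operator `H_Λ` acting on `ℓ²(Λ)`. -/
def ham (d : ℕ) (V : (Fin d → ℤ) → ℝ) (Λ : Finset (Fin d → ℤ)) :
    (↥Λ → ℂ) →ₗ[ℂ] (↥Λ → ℂ) :=
  Matrix.toLin' (hamMat d V Λ)

/-- The number of eigenvalues of `H_Λ` in `[E, E+ε]`, counted with multiplicity, i.e. the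
dimension of the span of the eigenspaces of `H_Λ` for eigenvalues `μ ∈ [E, E+ε]`. -/
def eigCount (d : ℕ) (V : (Fin d → ℤ) → ℝ) (Λ : Finset (Fin d → ℤ)) (E ε : ℝ) : ℕ :=
  Module.finrank ℂ
    ↥(⨆ μ ∈ Set.Icc E (E + ε), Module.End.eigenspace (ham d V Λ) (μ : ℂ))

end

section

open Finset

lemma sum_comp_le {ι : Type*} [Fintype ι] [DecidableEq ι] {S : Finset ι} {p : ι → ι}
    (hp : Set.InjOn p S) {g : ι → ℝ} (hg : ∀ z, 0 ≤ g z) : ∑ x ∈ S, g (p x) ≤ ∑ z, g z := by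
  rw [← Finset.sum_image (f := g) hp]
  exact Finset.sum_le_sum_of_subset_of_nonneg (Finset.subset_univ _) fun z _ _ => hg z

theorem weighted_sum_sq_le {ι : Type*} [Fintype ι] [DecidableEq ι] (A : Matrix ι ι ℂ)
    {M : ℝ} {D : ℕ} (hM : ∀ z y, ‖A z y‖ ≤ M)
    (hrow : ∀ z, (univ.filter fun y => A z y ≠ 0).card ≤ D)
    (hcol : ∀ y, (univ.filter fun z => A z y ≠ 0).card ≤ D)
    {S : Finset ι} {p : ι → ι} (hp : Set.InjOn p S) (hpA : ∀ x ∈ S, ‖A (p x) x‖ = 1)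
    {r : ι → ℕ} (hr : ∀ x ∈ S, r (p x) < r x)
    (hr' : ∀ x ∈ S, ∀ y, y ≠ x → A (p x) y ≠ 0 → r y < r x)
    {ψ : ι → ℂ} (hψ : ∀ x, x ∉ S → ψ x = 0)
    {θ : ℝ} (hθ : 4 + 4 * (D : ℝ) ^ 2 * M ^ 2 ≤ θ) :
    ∑ x, θ⁻¹ ^ r x * ‖ψ x‖ ^ 2 ≤ ∑ x, θ⁻¹ ^ r x * ‖(A.mulVec ψ) x‖ ^ 2 := by
  have hθ1 : 1 ≤ θ := by nlinarith [sq_nonneg ((D : ℝ) * M)]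
  have hθ0 : 0 < θ := by linarith
  have hw : ∀ x y, r y < r x → θ⁻¹ ^ r x ≤ θ⁻¹ * θ⁻¹ ^ r y := fun x y h => by
    rw [← pow_succ']
    exact pow_le_pow_of_le_one (by positivity) (inv_le_one_of_one_le₀ hθ1) h
  set g : ι → ℝ := fun z => ∑ y ∈ univ.filter (fun y => A z y ≠ 0), θ⁻¹ ^ r y * ‖ψ y‖ ^ 2 with hg
  have hg0 : ∀ z, 0 ≤ g z := fun z => Finset.sum_nonneg fun y _ => by positivity
  have hpt : ∀ x ∈ S, θ⁻¹ ^ r x * ‖ψ x‖ ^ 2 ≤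
      2 * θ⁻¹ * (θ⁻¹ ^ r (p x) * ‖(A.mulVec ψ) (p x)‖ ^ 2) + 2 * θ⁻¹ * (D * M ^ 2) * g (p x) := by
    intro x hx
    set N := (univ.filter fun y => A (p x) y ≠ 0).erase x with hN
    have hsplit : (A.mulVec ψ) (p x) = A (p x) x * ψ x + ∑ y ∈ N, A (p x) y * ψ y := by
      have hxm : x ∈ univ.filter fun y => A (p x) y ≠ 0 := by
        simp only [mem_filter, mem_univ, true_and]
        intro h
        simpa [h] using hpA x hx
      rw [hN, Finset.add_sum_erase _ (fun y => A (p x) y * ψ y) hxm, Finset.sum_filter_of_ne]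
      · rfl
      · intro y _ h
        exact left_ne_zero_of_mul h
    have hnorm : ‖ψ x‖ ≤ ‖(A.mulVec ψ) (p x)‖ + ∑ y ∈ N, M * ‖ψ y‖ := by
      have h1 : ‖ψ x‖ = ‖A (p x) x * ψ x‖ := by rw [norm_mul, hpA x hx, one_mul]
      have h2 : A (p x) x * ψ x = (A.mulVec ψ) (p x) - ∑ y ∈ N, A (p x) y * ψ y := by
        rw [hsplit]; ring
      rw [h1, h2]
      refine (norm_sub_le _ _).trans (by gcongr; refine (norm_sum_le _ _).trans ?_
                                         refine Finset.sum_le_sum fun y _ => ?_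
                                         rw [norm_mul]; gcongr; exact hM _ _)
    have hNc : (N.card : ℝ) ≤ D := by
      exact_mod_cast (Finset.card_le_card (Finset.erase_subset _ _)).trans (hrow (p x))
    have hcs : (∑ y ∈ N, M * ‖ψ y‖) ^ 2 ≤ D * M ^ 2 * ∑ y ∈ N, ‖ψ y‖ ^ 2 := by
      rw [← Finset.mul_sum, mul_pow]
      have h3 : (∑ y ∈ N, ‖ψ y‖) ^ 2 ≤ D * ∑ y ∈ N, ‖ψ y‖ ^ 2 :=
        sq_sum_le_card_mul_sum_sq.trans (by gcongr)
      nlinarith [mul_le_mul_of_nonneg_left h3 (sq_nonneg M)]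
    have hsq : ‖ψ x‖ ^ 2 ≤
        2 * ‖(A.mulVec ψ) (p x)‖ ^ 2 + 2 * (D * M ^ 2) * ∑ y ∈ N, ‖ψ y‖ ^ 2 := by
      have h4 := pow_le_pow_left₀ (norm_nonneg _) hnorm 2
      nlinarith [sq_nonneg (‖(A.mulVec ψ) (p x)‖ - ∑ y ∈ N, M * ‖ψ y‖)]
    have hgN : θ⁻¹ ^ r x * ∑ y ∈ N, ‖ψ y‖ ^ 2 ≤ θ⁻¹ * g (p x) := by
      rw [hg, Finset.mul_sum, Finset.mul_sum]
      refine (Finset.sum_le_sum fun y hy => ?_).trans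
        (Finset.sum_le_sum_of_subset_of_nonneg (Finset.erase_subset _ _)
          fun y _ _ => by positivity)
      simp only [hN, mem_erase, mem_filter, mem_univ, true_and] at hy
      rw [← mul_assoc]
      gcongr
      exact hw x y (hr' x hx y hy.1 hy.2)
    have hφ : θ⁻¹ ^ r x * ‖(A.mulVec ψ) (p x)‖ ^ 2 ≤
        θ⁻¹ * (θ⁻¹ ^ r (p x) * ‖(A.mulVec ψ) (p x)‖ ^ 2) := by
      rw [← mul_assoc]
      gcongr
      exact hw x _ (hr x hx)
    calc θ⁻¹ ^ r x * ‖ψ x‖ ^ 2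
        ≤ θ⁻¹ ^ r x *
          (2 * ‖(A.mulVec ψ) (p x)‖ ^ 2 + 2 * (D * M ^ 2) * ∑ y ∈ N, ‖ψ y‖ ^ 2) := by gcongr
      _ = 2 * (θ⁻¹ ^ r x * ‖(A.mulVec ψ) (p x)‖ ^ 2) +
          2 * (D * M ^ 2) * (θ⁻¹ ^ r x * ∑ y ∈ N, ‖ψ y‖ ^ 2) := by ring
      _ ≤ 2 * (θ⁻¹ * (θ⁻¹ ^ r (p x) * ‖(A.mulVec ψ) (p x)‖ ^ 2)) +
          2 * (D * M ^ 2) * (θ⁻¹ * g (p x)) := by gcongr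
      _ = _ := by ring
  have hgsum : ∑ z, g z ≤ D * ∑ y, θ⁻¹ ^ r y * ‖ψ y‖ ^ 2 := by
    simp only [hg, Finset.sum_filter]
    rw [Finset.sum_comm, Finset.mul_sum]
    refine Finset.sum_le_sum fun y _ => ?_
    rw [← Finset.sum_filter, Finset.sum_const, nsmul_eq_mul]
    gcongr
    exact hcol y
  have hS : ∑ x, θ⁻¹ ^ r x * ‖ψ x‖ ^ 2 = ∑ x ∈ S, θ⁻¹ ^ r x * ‖ψ x‖ ^ 2 := by
    symm
    refine Finset.sum_subset (Finset.subset_univ _) fun x _ hx => ?_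
    simp [hψ x hx]
  set a := ∑ x, θ⁻¹ ^ r x * ‖ψ x‖ ^ 2 with ha
  set b := ∑ x, θ⁻¹ ^ r x * ‖(A.mulVec ψ) x‖ ^ 2 with hb
  have ha0 : 0 ≤ a := Finset.sum_nonneg fun y _ => by positivity
  have hb0 : 0 ≤ b := Finset.sum_nonneg fun y _ => by positivity
  have hmain : a ≤ 2 * θ⁻¹ * b + 2 * θ⁻¹ * (D * M ^ 2) * (D * a) := by
    refine hS.le.trans ((Finset.sum_le_sum hpt).trans ?_)
    rw [Finset.sum_add_distrib, ← Finset.mul_sum, ← Finset.mul_sum]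
    gcongr
    · exact sum_comp_le (g := fun z => θ⁻¹ ^ r z * ‖(A.mulVec ψ) z‖ ^ 2) hp
        fun z => by positivity
    · exact (sum_comp_le hp hg0).trans hgsum
  have hmul : θ * a ≤ 2 * b + 2 * ((D : ℝ) ^ 2 * M ^ 2) * a := by
    have h := mul_le_mul_of_nonneg_left hmain hθ0.le
    have e : θ * (2 * θ⁻¹ * b + 2 * θ⁻¹ * (D * M ^ 2) * (D * a)) =
        2 * b + 2 * ((D : ℝ) ^ 2 * M ^ 2) * a := by field_simp
    linarith
  have hDM : 0 ≤ (D : ℝ) ^ 2 * M ^ 2 := by positivity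
  nlinarith [mul_le_mul_of_nonneg_right hθ ha0, mul_nonneg hDM ha0]

theorem eq_zero_of_sum_sq_mulVec_le {ι : Type*} [Fintype ι] [DecidableEq ι] (A : Matrix ι ι ℂ)
    {M : ℝ} {D : ℕ} (hM : ∀ z y, ‖A z y‖ ≤ M)
    (hrow : ∀ z, (univ.filter fun y => A z y ≠ 0).card ≤ D)
    (hcol : ∀ y, (univ.filter fun z => A z y ≠ 0).card ≤ D)
    {S : Finset ι} {p : ι → ι} (hp : Set.InjOn p S) (hpA : ∀ x ∈ S, ‖A (p x) x‖ = 1)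
    {r : ι → ℕ} (hr : ∀ x ∈ S, r (p x) < r x)
    (hr' : ∀ x ∈ S, ∀ y, y ≠ x → A (p x) y ≠ 0 → r y < r x)
    {ψ : ι → ℂ} (hψ : ∀ x, x ∉ S → ψ x = 0)
    {θ : ℝ} (hθ : 4 + 4 * (D : ℝ) ^ 2 * M ^ 2 ≤ θ) {R : ℕ} (hR : ∀ x, r x ≤ R)
    {ε : ℝ} (hε : ε ^ 2 * θ ^ R < 1)
    (hle : ∑ x, ‖(A.mulVec ψ) x‖ ^ 2 ≤ ε ^ 2 * ∑ x, ‖ψ x‖ ^ 2) : ψ = 0 := by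
  have hθ1 : 1 ≤ θ := by nlinarith [sq_nonneg ((D : ℝ) * M)]
  have hθ0 : 0 < θ := by linarith
  have hi1 : θ⁻¹ ≤ 1 := inv_le_one_of_one_le₀ hθ1
  have h := weighted_sum_sq_le A hM hrow hcol hp hpA hr hr' hψ hθ
  have h1 : ∑ x, θ⁻¹ ^ r x * ‖(A.mulVec ψ) x‖ ^ 2 ≤ ∑ x, ‖(A.mulVec ψ) x‖ ^ 2 :=
    Finset.sum_le_sum fun x _ =>
      mul_le_of_le_one_left (by positivity) (pow_le_one₀ (by positivity) hi1)
  have h2 : θ⁻¹ ^ R * ∑ x, ‖ψ x‖ ^ 2 ≤ ∑ x, θ⁻¹ ^ r x * ‖ψ x‖ ^ 2 := by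
    rw [Finset.mul_sum]
    refine Finset.sum_le_sum fun x _ => ?_
    gcongr ?_ * _
    exact pow_le_pow_of_le_one (by positivity) hi1 (hR x)
  set s := ∑ x, ‖ψ x‖ ^ 2 with hs
  have hs0 : 0 ≤ s := Finset.sum_nonneg fun y _ => by positivity
  have h3 : s ≤ (ε ^ 2 * θ ^ R) * s := by
    have h4 : θ⁻¹ ^ R * s ≤ ε ^ 2 * s := h2.trans (h.trans (h1.trans hle))
    have h5 := mul_le_mul_of_nonneg_left h4 (pow_nonneg hθ0.le R)
    rw [← mul_assoc, ← mul_pow, mul_inv_cancel₀ hθ0.ne', one_pow, one_mul] at h5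
    linarith
  have hs' : s = 0 := by
    by_contra hne
    have : 0 < s := lt_of_le_of_ne hs0 (Ne.symm hne)
    nlinarith
  funext x
  have := (Finset.sum_eq_zero_iff_of_nonneg fun y _ => by positivity).1 hs' x (mem_univ x)
  simpa using this

theorem sum_sq_mulVec_sub_le_of_mem_iSup_eigenspace {ι : Type*} [Fintype ι] [DecidableEq ι]
    {A : Matrix ι ι ℂ} (hA : A.IsHermitian) {E ε : ℝ} {ψ : ι → ℂ}
    (hψ : ψ ∈ ⨆ μ ∈ Set.Icc E (E + ε), Module.End.eigenspace (Matrix.toLin' A) (μ : ℂ)) :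
    ∑ x, ‖((A - (E : ℂ) • (1 : Matrix ι ι ℂ)).mulVec ψ) x‖ ^ 2 ≤ ε ^ 2 * ∑ x, ‖ψ x‖ ^ 2 := by
  rw [iSup_subtype', Submodule.mem_iSup_iff_exists_finsupp] at hψ
  obtain ⟨f, hf, rfl⟩ := hψ
  have hev : ∀ μ, A.mulVec (f μ) = ((μ : ℝ) : ℂ) • f μ := fun μ => by
    simpa [Module.End.mem_eigenspace_iff] using hf μ
  let g : Set.Icc E (E + ε) → EuclideanSpace ℂ ι := fun μ => WithLp.toLp 2 (f μ)
  have horth : ∀ μ ν, μ ≠ ν → inner ℂ (g μ) (g ν) = 0 := by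
    intro μ ν hne
    have hsym := (Matrix.isSymmetric_toEuclideanLin_iff.2 hA) (g μ) (g ν)
    have e : ∀ μ, Matrix.toEuclideanLin A (g μ) = ((μ : ℝ) : ℂ) • g μ := fun μ => by
      simp [g, Matrix.toLpLin_apply, hev]
    rw [e, e, inner_smul_left, inner_smul_right, Complex.conj_ofReal] at hsym
    have : (((μ : ℝ) : ℂ) - ((ν : ℝ) : ℂ)) * inner ℂ (g μ) (g ν) = 0 := by
      rw [sub_mul, hsym, sub_self]
    refine (mul_eq_zero.1 this).resolve_left fun h => hne ?_
    exact Subtype.ext (by exact_mod_cast sub_eq_zero.1 h)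
  have hin : ∀ v : EuclideanSpace ℂ ι, ((‖v‖ ^ 2 : ℝ) : ℂ) = inner ℂ v v := fun v => by
    rw [inner_self_eq_norm_sq_to_K]
    push_cast
    rfl
  have hpyth : ∀ c : Set.Icc E (E + ε) → ℂ, ‖∑ μ ∈ f.support, c μ • g μ‖ ^ 2 =
      ∑ μ ∈ f.support, ‖c μ‖ ^ 2 * ‖g μ‖ ^ 2 := by
    intro c
    have : ((‖∑ μ ∈ f.support, c μ • g μ‖ ^ 2 : ℝ) : ℂ) =
        ((∑ μ ∈ f.support, ‖c μ‖ ^ 2 * ‖g μ‖ ^ 2 : ℝ) : ℂ) := by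
      rw [hin, sum_inner, Complex.ofReal_sum]
      refine Finset.sum_congr rfl fun μ hμ => ?_
      rw [inner_sum, Finset.sum_eq_single_of_mem μ hμ]
      · rw [← mul_pow, ← norm_smul, hin]
      · intro ν _ hne
        rw [inner_smul_left, inner_smul_right, horth μ ν hne.symm, mul_zero, mul_zero]
    exact_mod_cast this
  have h1 : ∑ x, ‖(f.sum fun _ y => y) x‖ ^ 2 = ∑ μ ∈ f.support, ‖g μ‖ ^ 2 := by
    have := hpyth 1
    simp only [Pi.one_apply, one_smul, norm_one, one_pow, one_mul] at this
    rw [← this, EuclideanSpace.norm_sq_eq]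
    simp [g, Finsupp.sum]
  have h2 : ∑ x, ‖((A - (E : ℂ) • (1 : Matrix ι ι ℂ)).mulVec (f.sum fun _ y => y)) x‖ ^ 2 =
      ∑ μ ∈ f.support, ‖((μ : ℝ) : ℂ) - E‖ ^ 2 * ‖g μ‖ ^ 2 := by
    rw [← hpyth fun μ => ((μ : ℝ) : ℂ) - E, EuclideanSpace.norm_sq_eq]
    have : (A - (E : ℂ) • (1 : Matrix ι ι ℂ)).mulVec (f.sum fun _ y => y) =
        ∑ μ ∈ f.support, (((μ : ℝ) : ℂ) - E) • f μ := by
      rw [Finsupp.sum, Matrix.mulVec_sum]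
      refine Finset.sum_congr rfl fun μ _ => ?_
      rw [Matrix.sub_mulVec, Matrix.smul_mulVec, Matrix.one_mulVec, hev, sub_smul]
    rw [this]
    simp [g]
  rw [h1, h2, Finset.mul_sum]
  refine Finset.sum_le_sum fun μ _ => ?_
  gcongr
  rw [← Complex.ofReal_sub, Complex.norm_real, Real.norm_eq_abs,
    abs_of_nonneg (by linarith [μ.2.1])]
  linarith [μ.2.2]

section Box

lemma emod_sub_of_two_le_emod {k R j : ℤ} (hR : 0 < R) (hk : 2 ≤ k % R) (hj0 : 0 ≤ j)
    (hj : j ≤ 2) : (k - j) % R = k % R - j := by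
  have h : k - j = (k % R - j) + R * (k / R) := by
    have := Int.emod_add_mul_ediv k R
    linarith
  have hlt := Int.emod_lt_of_pos k hR
  rw [h, Int.add_mul_emod_self_left, Int.emod_eq_of_lt (by linarith) (by linarith)]

lemma card_filter_emod_lt_two_mul_le {a m R : ℤ} (hR : 0 < R) (hRm : R ≤ 2 * m + 1) :
    (((Finset.Icc a (a + 2 * m)).filter fun k => (k - a) % R < 2).card : ℤ) * R ≤
      4 * (2 * m + 1) := by
  have hcard : ((Finset.Icc a (a + 2 * m)).filter fun k => (k - a) % R < 2).card ≤
      (Finset.Icc (0 : ℤ) (2 * m / R) ×ˢ Finset.Ico (0 : ℤ) 2).card := by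
    refine Finset.card_le_card_of_injOn (fun k => ((k - a) / R, (k - a) % R)) ?_ ?_
    · intro k hk
      simp only [coe_filter, Finset.mem_Icc, Set.mem_ofPred_eq] at hk
      simp only [coe_product, Set.mem_prod, coe_Icc, coe_Ico, Set.mem_Icc, Set.mem_Ico]
      exact ⟨⟨Int.ediv_nonneg (by linarith) hR.le, Int.ediv_le_ediv hR (by linarith)⟩,
        Int.emod_nonneg _ hR.ne', hk.2⟩
    · intro k _ l _ h
      simp only [Prod.mk.injEq] at h
      have h1 := Int.emod_add_mul_ediv (k - a) R
      have h2 := Int.emod_add_mul_ediv (l - a) R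
      rw [h.1, h.2] at h1
      linarith
  have hm : 0 ≤ 2 * m := by omega
  have hq : 0 ≤ 2 * m / R := Int.ediv_nonneg hm hR.le
  have hqR : 2 * m / R * R ≤ 2 * m := Int.ediv_mul_le _ hR.ne'
  have hcard' : (((Finset.Icc a (a + 2 * m)).filter fun k => (k - a) % R < 2).card : ℤ) ≤
      (2 * m / R + 1) * 2 := by
    refine (Int.ofNat_le.2 hcard).trans (le_of_eq ?_)
    rw [Finset.card_product, Int.card_Icc, Int.card_Ico]
    push_cast
    rw [Int.toNat_of_nonneg (by linarith)]
    norm_num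
  nlinarith [mul_le_mul_of_nonneg_right hcard' hR.le]

/-- The position of `x`, within its slab of thickness `R`, of the box `boxZ (n + 1) x₀ L` cut
orthogonally to the first coordinate axis. -/
noncomputable def slabDepth {n : ℕ} (x₀ : Fin (n + 1) → ℤ) (L : ℝ) (R : ℕ)
    (x : Fin (n + 1) → ℤ) : ℕ :=
  ((x 0 - (x₀ 0 - ⌊L / 2⌋)) % R).toNat

lemma card_slabDepth_lt_two_mul_le {n : ℕ} (x₀ : Fin (n + 1) → ℤ) (L : ℝ) {R : ℕ} (hR : 0 < R)
    (hRL : (R : ℤ) ≤ 2 * ⌊L / 2⌋ + 1) :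
    ((boxZ (n + 1) x₀ L).filter fun x => slabDepth x₀ L R x < 2).card * R ≤
      4 * (boxZ (n + 1) x₀ L).card := by
  set m := ⌊L / 2⌋ with hm
  have hR' : (0 : ℤ) < R := by exact_mod_cast hR
  set T := (Finset.Icc (x₀ 0 - m) (x₀ 0 - m + 2 * m)).filter
    fun k => (k - (x₀ 0 - m)) % (R : ℤ) < 2 with hT
  have hsub : ((boxZ (n + 1) x₀ L).filter fun x => slabDepth x₀ L R x < 2) ⊆
      Fintype.piFinset (Fin.cons T fun i : Fin n =>
        Finset.Icc (x₀ i.succ - m) (x₀ i.succ + m)) := by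
    intro x hx
    rw [mem_filter] at hx
    simp only [boxZ, Fintype.mem_piFinset, slabDepth, ← hm] at hx
    rw [Fintype.mem_piFinset]
    intro i
    refine Fin.cases ?_ (fun j => ?_) i
    · have h0 := Finset.mem_Icc.1 (hx.1 0)
      rw [Fin.cons_zero, hT, mem_filter, Finset.mem_Icc]
      refine ⟨⟨h0.1, by linarith [h0.2]⟩, ?_⟩
      have := hx.2
      have hnn := Int.emod_nonneg (x 0 - (x₀ 0 - m)) hR'.ne'
      omega
    · rw [Fin.cons_succ]
      exact hx.1 j.succ
  have hTc : T.card * R ≤ 4 * (Finset.Icc (x₀ 0 - m) (x₀ 0 + m)).card := by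
    have h := card_filter_emod_lt_two_mul_le (a := x₀ 0 - m) hR' hRL
    have hc : ((Finset.Icc (x₀ 0 - m) (x₀ 0 + m)).card : ℤ) = 2 * m + 1 := by
      rw [Int.card_Icc, Int.toNat_of_nonneg (by linarith)]
      ring
    rw [← hT, ← hc] at h
    exact_mod_cast h
  have hle := Finset.card_le_card hsub
  rw [Fintype.card_piFinset, Fin.prod_univ_succ] at hle
  simp only [Fin.cons_zero, Fin.cons_succ] at hle
  have hbox : (boxZ (n + 1) x₀ L).card = (Finset.Icc (x₀ 0 - m) (x₀ 0 + m)).card *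
      ∏ i : Fin n, (Finset.Icc (x₀ i.succ - m) (x₀ i.succ + m)).card := by
    rw [boxZ, Fintype.card_piFinset, Fin.prod_univ_succ]
  rw [hbox]
  calc _ ≤ _ := Nat.mul_le_mul_right R hle
    _ = (T.card * R) * ∏ i : Fin n, (Finset.Icc (x₀ i.succ - m) (x₀ i.succ + m)).card := by ring
    _ ≤ _ := Nat.mul_le_mul_right _ hTc
    _ = _ := by ring

end Box

section Hamiltonian

variable {d : ℕ} {V : (Fin d → ℤ) → ℝ} {Λ : Finset (Fin d → ℤ)}

lemma hamMat_isHermitian : (hamMat d V Λ).IsHermitian := by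
  ext x y
  rw [Matrix.conjTranspose_apply]
  simp only [hamMat, abs_sub_comm (y.1 _) (x.1 _)]
  by_cases hxy : x = y
  · subst hxy
    simp
  · simp only [hxy, Ne.symm hxy, if_false]
    split_ifs <;> simp

lemma hamMat_sub_smul_one_apply (E : ℝ) (x y : Λ) :
    (hamMat d V Λ - (E : ℂ) • (1 : Matrix Λ Λ ℂ)) x y =
      (if (∑ i, |x.1 i - y.1 i|) = 1 then -1 else 0) +
        (if x = y then ((V x.1 - E : ℝ) : ℂ) else 0) := by
  by_cases hxy : x = y
  · subst hxy
    simp [hamMat]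
  · simp [hamMat, hxy]

lemma norm_hamMat_sub_smul_one_apply_le {v : ℝ} (hV : ∀ x, |V x| ≤ v) (E : ℝ) (x y : Λ) :
    ‖(hamMat d V Λ - (E : ℂ) • (1 : Matrix Λ Λ ℂ)) x y‖ ≤ 1 + v + |E| := by
  have hv : 0 ≤ v := (abs_nonneg _).trans (hV x.1)
  rw [hamMat_sub_smul_one_apply, add_assoc]
  refine (norm_add_le _ _).trans (add_le_add ?_ ?_)
  · split_ifs <;> simp
  · split_ifs
    · rw [Complex.norm_real, Real.norm_eq_abs]
      exact (abs_sub _ _).trans (by gcongr; exact hV _)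
    · simpa using add_nonneg hv (abs_nonneg E)

lemma eq_or_sum_abs_sub_eq_one {E : ℝ} {x y : Λ}
    (h : (hamMat d V Λ - (E : ℂ) • (1 : Matrix Λ Λ ℂ)) x y ≠ 0) :
    x = y ∨ (∑ i, |x.1 i - y.1 i|) = 1 := by
  by_contra! hne
  rw [hamMat_sub_smul_one_apply, if_neg hne.1, if_neg hne.2, add_zero] at h
  exact h rfl

lemma abs_sub_le_one_of_apply_ne_zero {E : ℝ} {x y : Λ}
    (h : (hamMat d V Λ - (E : ℂ) • (1 : Matrix Λ Λ ℂ)) x y ≠ 0) (i : Fin d) :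
    |x.1 i - y.1 i| ≤ 1 := by
  rcases eq_or_sum_abs_sub_eq_one h with rfl | h
  · simp
  · rw [← h]
    exact Finset.single_le_sum (f := fun i => |x.1 i - y.1 i|) (fun _ _ => abs_nonneg _)
      (Finset.mem_univ i)

lemma card_filter_le_three_pow {P : Λ → Prop} [DecidablePred P] (x : Λ)
    (hP : ∀ y, P y → ∀ i, |x.1 i - y.1 i| ≤ 1) : (univ.filter P).card ≤ 3 ^ d := by
  have hcard : (Fintype.piFinset fun i => Finset.Icc (x.1 i - 1) (x.1 i + 1)).card = 3 ^ d := by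
    have h3 : ∀ k : ℤ, k + 1 + 1 - (k - 1) = 3 := fun k => by ring
    simp [Fintype.card_piFinset, Int.card_Icc, h3]
  rw [← hcard]
  refine Finset.card_le_card_of_injOn Subtype.val (fun y hy => ?_) Subtype.val_injective.injOn
  simp only [coe_filter, mem_univ, true_and, Set.mem_ofPred_eq] at hy
  rw [Finset.mem_coe, Fintype.mem_piFinset]
  intro i
  have := abs_le.1 (hP y hy i)
  rw [Finset.mem_Icc]
  constructor <;> linarith [this.1, this.2]

lemma card_row_le (E : ℝ) (x : Λ) : (univ.filter fun y =>
    (hamMat d V Λ - (E : ℂ) • (1 : Matrix Λ Λ ℂ)) x y ≠ 0).card ≤ 3 ^ d :=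
  card_filter_le_three_pow x fun _ h => abs_sub_le_one_of_apply_ne_zero h

lemma card_col_le (E : ℝ) (y : Λ) : (univ.filter fun x =>
    (hamMat d V Λ - (E : ℂ) • (1 : Matrix Λ Λ ℂ)) x y ≠ 0).card ≤ 3 ^ d :=
  card_filter_le_three_pow y fun x h i => by
    rw [abs_sub_comm]
    exact abs_sub_le_one_of_apply_ne_zero h i

lemma abs_le_of_hasEigenvalue_ham {v : ℝ} (hV : ∀ x, |V x| ≤ v) {μ : ℝ}
    (hμ : Module.End.HasEigenvalue (ham d V Λ) (μ : ℂ)) : |μ| ≤ 3 ^ d * (1 + v) := by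
  obtain ⟨k, hk⟩ := eigenvalue_mem_ball hμ
  rw [mem_closedBall_iff_norm] at hk
  have hsum : ‖(μ : ℂ)‖ ≤ ∑ j, ‖hamMat d V Λ k j‖ := by
    rw [← Finset.add_sum_erase univ _ (Finset.mem_univ k)]
    have := norm_sub_norm_le (μ : ℂ) (hamMat d V Λ k k)
    linarith
  rw [Complex.norm_real, Real.norm_eq_abs] at hsum
  refine hsum.trans ?_
  have hrow := card_row_le (V := V) 0 k
  have hnorm := fun j => norm_hamMat_sub_smul_one_apply_le hV 0 k j
  simp only [Complex.ofReal_zero, zero_smul, sub_zero, abs_zero, add_zero] at hrow hnorm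
  have hv : 0 ≤ v := (abs_nonneg _).trans (hV k.1)
  rw [← Finset.sum_filter_of_ne (p := fun j => hamMat d V Λ k j ≠ 0)
    fun j _ h => norm_ne_zero_iff.1 h]
  refine (Finset.sum_le_card_nsmul _ _ _ fun j _ => hnorm j).trans ?_
  rw [nsmul_eq_mul]
  gcongr
  exact_mod_cast hrow

lemma eigCount_le_card (E ε : ℝ) : eigCount d V Λ E ε ≤ Λ.card := by
  refine (Submodule.finrank_le _).trans ?_
  simp

lemma eigCount_le_card_of_vanishing {E ε : ℝ} (P : Finset Λ)
    (h : ∀ ψ ∈ ⨆ μ ∈ Set.Icc E (E + ε), Module.End.eigenspace (ham d V Λ) (μ : ℂ),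
      (∀ x ∈ P, ψ x = 0) → ψ = 0) : eigCount d V Λ E ε ≤ P.card := by
  set W := ⨆ μ ∈ Set.Icc E (E + ε), Module.End.eigenspace (ham d V Λ) (μ : ℂ) with hW
  let f : W →ₗ[ℂ] (P → ℂ) := (LinearMap.funLeft ℂ ℂ (Subtype.val : P → Λ)).comp W.subtype
  have hf : Function.Injective f := by
    rw [injective_iff_map_eq_zero]
    intro ψ hψ
    exact Subtype.ext (h ψ.1 ψ.2 fun x hx => congrFun hψ ⟨x, hx⟩)
  have := LinearMap.finrank_le_finrank_of_injective hf
  simpa [eigCount, ← hW] using this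

end Hamiltonian

lemma eigCount_mul_le {n : ℕ} {V : (Fin (n + 1) → ℤ) → ℝ} {v : ℝ} (hV : ∀ x, |V x| ≤ v)
    {E ε : ℝ} (x₀ : Fin (n + 1) → ℤ) (L : ℝ) {R : ℕ} (hR : 0 < R)
    (hRL : (R : ℤ) ≤ 2 * ⌊L / 2⌋ + 1) {θ : ℝ}
    (hθ : 4 + 4 * ((3 ^ (n + 1) : ℕ) : ℝ) ^ 2 * (1 + v + |E|) ^ 2 ≤ θ)
    (hε : ε ^ 2 * θ ^ R < 1) :
    eigCount (n + 1) V (boxZ (n + 1) x₀ L) E ε * R ≤ 4 * (boxZ (n + 1) x₀ L).card := by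
  set Λ := boxZ (n + 1) x₀ L with hΛ
  have hR' : (0 : ℤ) < R := by exact_mod_cast hR
  let r : Λ → ℕ := fun x => slabDepth x₀ L R x.1
  let S : Finset Λ := univ.filter fun x => 2 ≤ r x
  have hS : ∀ x, x ∈ S ↔ 2 ≤ (x.1 0 - (x₀ 0 - ⌊L / 2⌋)) % R := fun x => by
    have := Int.emod_nonneg (x.1 0 - (x₀ 0 - ⌊L / 2⌋)) hR'.ne'
    simp only [S, mem_filter, mem_univ, true_and]
    simp only [r, slabDepth]
    omega
  have hr_lt : ∀ x ∈ S, ∀ y : Λ, x.1 0 - 2 ≤ y.1 0 → y.1 0 ≤ x.1 0 - 1 → r y < r x := by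
    intro x hx y h2 h1
    have hx' := (hS x).1 hx
    have h := emod_sub_of_two_le_emod (j := x.1 0 - y.1 0) hR' hx' (by linarith) (by linarith)
    have e : x.1 0 - (x₀ 0 - ⌊L / 2⌋) - (x.1 0 - y.1 0) = y.1 0 - (x₀ 0 - ⌊L / 2⌋) := by ring
    rw [e] at h
    simp only [r, slabDepth]
    omega
  have hmem : ∀ x ∈ S, x.1 - Pi.single 0 1 ∈ Λ := by
    intro x hx
    have hx' := (hS x).1 hx
    have hxΛ := x.2
    simp only [hΛ, boxZ, Fintype.mem_piFinset, Finset.mem_Icc] at hxΛ ⊢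
    intro i
    refine Fin.cases ?_ (fun j => ?_) i
    · have h0 := hxΛ 0
      have hne : x.1 0 - (x₀ 0 - ⌊L / 2⌋) ≠ 0 := fun h => by
        rw [h] at hx'
        simp at hx'
      simp only [Pi.sub_apply, Pi.single_eq_same]
      omega
    · simpa using hxΛ j.succ
  let p : Λ → Λ := fun x => if h : x.1 - Pi.single 0 1 ∈ Λ then ⟨_, h⟩ else x
  have hp : ∀ x ∈ S, (p x).1 = x.1 - Pi.single 0 1 := fun x hx => by
    simp only [p, dif_pos (hmem x hx)]
  have hp0 : ∀ x ∈ S, (p x).1 0 = x.1 0 - 1 := fun x hx => by simp [hp x hx]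
  have hps : ∀ x ∈ S, ∀ i : Fin n, (p x).1 i.succ = x.1 i.succ := fun x hx i => by
    simp [hp x hx]
  set A := hamMat (n + 1) V Λ - (E : ℂ) • (1 : Matrix Λ Λ ℂ) with hA
  have hcount : eigCount (n + 1) V Λ E ε ≤ Sᶜ.card := by
    refine eigCount_le_card_of_vanishing _ fun ψ hψ hvan => ?_
    refine eq_zero_of_sum_sq_mulVec_le A (D := 3 ^ (n + 1)) (S := S) (p := p) (r := r)
      (norm_hamMat_sub_smul_one_apply_le hV E) (card_row_le E) (card_col_le E) ?_ ?_ ?_ ?_ ?_ hθ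
      (R := R) ?_ hε (sum_sq_mulVec_sub_le_of_mem_iSup_eigenspace hamMat_isHermitian hψ)
    · intro x hx y hy h
      have h' := congrArg Subtype.val h
      rw [hp x hx, hp y hy] at h'
      exact Subtype.ext (sub_left_injective h')
    · intro x hx
      have hne : p x ≠ x := fun h => by
        have := hp0 x hx
        rw [h] at this
        omega
      rw [hA, hamMat_sub_smul_one_apply, if_neg hne, Fin.sum_univ_succ, hp0 x hx]
      simp [hps x hx]
    · intro x hx
      have := hp0 x hx
      exact hr_lt x hx _ (by omega) (by omega)
    · intro x hx y hyx hne
      have h0 := abs_le.1 (abs_sub_le_one_of_apply_ne_zero hne 0)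
      rw [hp0 x hx] at h0
      refine hr_lt x hx y (by linarith [h0.2]) ?_
      rcases eq_or_sum_abs_sub_eq_one hne with h | h
      · rw [← h, hp0 x hx]
      · by_contra! hlt
        have hy0 : y.1 0 = x.1 0 := by linarith [h0.1]
        rw [Fin.sum_univ_succ, hp0 x hx, hy0] at h
        have hz : ∑ i : Fin n, |(p x).1 i.succ - y.1 i.succ| = 0 := by simpa using h
        rw [Finset.sum_eq_zero_iff_of_nonneg fun _ _ => abs_nonneg _] at hz
        refine hyx (Subtype.ext (funext fun i => Fin.cases hy0 (fun j => ?_) i))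
        have hj := hz j (mem_univ j)
        rw [hps x hx, abs_eq_zero, sub_eq_zero] at hj
        exact hj.symm
    · intro x hx
      exact hvan x (Finset.mem_compl.2 hx)
    · intro x
      have := Int.emod_lt_of_pos (x.1 0 - (x₀ 0 - ⌊L / 2⌋)) hR'
      simp only [r, slabDepth]
      omega
  have hcompl : Sᶜ.card ≤ (Λ.filter fun x => slabDepth x₀ L R x < 2).card := by
    refine Finset.card_le_card_of_injOn Subtype.val (fun x hx => ?_) Subtype.val_injective.injOn
    simp only [S, r, coe_compl, coe_filter, mem_univ, true_and, Set.mem_compl_iff,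
      Set.mem_ofPred_eq, not_le] at hx ⊢
    exact ⟨x.2, hx⟩
  exact (Nat.mul_le_mul_right R (hcount.trans hcompl)).trans
    (card_slabDepth_lt_two_mul_le x₀ L hR hRL)

end

/-- For `d ≥ 1` and `‖V‖_∞ ≤ Vinf` there are constants `C, L₀ > 0`,
depending only on `d` and `Vinf`, such that for `0 < ε ≤ 1/2`, any `E`, `x₀` and any
`L ≥ L₀ log(1/ε)`, the number of eigenvalues of `H_Λ`, `Λ = Λ_L(x₀)`, in `[E, E+ε]`,
counted with multiplicity, is at most `C |Λ| / log(1/ε)`. -/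
theorem discrete_dos_bound (d : ℕ) (hd : 1 ≤ d) (Vinf : ℝ) :
    ∃ C > (0 : ℝ), ∃ L₀ > (0 : ℝ), ∀ V : (Fin d → ℤ) → ℝ, (∀ x, |V x| ≤ Vinf) →
      ∀ ε E : ℝ, 0 < ε → ε ≤ 1 / 2 → ∀ x₀ : Fin d → ℤ, ∀ L : ℝ,
        L₀ * Real.log (1 / ε) ≤ L →
        (eigCount d V (boxZ d x₀ L) E ε : ℝ) ≤
          C * (boxZ d x₀ L).card / Real.log (1 / ε) := by
  obtain ⟨n, rfl⟩ : ∃ n, d = n + 1 := ⟨d - 1, by omega⟩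
  set v := |Vinf| with hv
  set E₀ := 3 ^ (n + 1) * (1 + v) + 1 with hE₀
  set θ : ℝ := 4 + 4 * ((3 ^ (n + 1) : ℕ) : ℝ) ^ 2 * (1 + v + E₀) ^ 2 with hθ
  have hθ4 : 4 ≤ θ := le_add_of_nonneg_right (by positivity)
  have hθ0 : 0 < θ := by linarith
  have hlogθ : 1 ≤ Real.log θ := by
    rw [Real.le_log_iff_exp_le hθ0]
    linarith [Real.exp_one_lt_d9]
  have hlogθ0 : 0 ≤ Real.log θ := by linarith
  clear_value θ E₀
  refine ⟨4 * Real.log θ, by linarith, 4, by norm_num, ?_⟩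
  intro V hV ε E hε hε2 x₀ L hL
  set ℓ := Real.log (1 / ε) with hℓ
  have hℓ0 : 0 < ℓ := Real.log_pos (by rw [lt_div_iff₀ hε]; linarith)
  have hεℓ : ε = Real.exp (-ℓ) := by
    rw [hℓ, one_div, Real.log_inv, neg_neg, Real.exp_log hε]
  have hV' : ∀ x, |V x| ≤ v := fun x => (hV x).trans (le_abs_self _)
  set Λ := boxZ (n + 1) x₀ L with hΛ
  have hc0 : (0 : ℝ) ≤ Λ.card := Nat.cast_nonneg _
  rw [le_div_iff₀ hℓ0]
  by_cases hsmall : ℓ ≤ Real.log θ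
  · have h : (eigCount (n + 1) V Λ E ε : ℝ) ≤ Λ.card := by exact_mod_cast eigCount_le_card E ε
    calc (eigCount (n + 1) V Λ E ε : ℝ) * ℓ ≤ Λ.card * Real.log θ :=
        mul_le_mul h hsmall hℓ0.le hc0
      _ ≤ 4 * Real.log θ * Λ.card := by nlinarith [mul_nonneg hc0 hlogθ0]
  push Not at hsmall
  by_cases hev : ∃ μ ∈ Set.Icc E (E + ε), Module.End.HasEigenvalue (ham (n + 1) V Λ) (μ : ℂ)
  · obtain ⟨μ, hμ, hμe⟩ := hev
    have hE : |E| ≤ E₀ := by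
      have h1 := abs_le.1 (abs_le_of_hasEigenvalue_ham hV' hμe)
      rw [abs_le]
      constructor <;> linarith [h1.1, h1.2, hμ.1, hμ.2]
    have hθE : 4 + 4 * ((3 ^ (n + 1) : ℕ) : ℝ) ^ 2 * (1 + v + |E|) ^ 2 ≤ θ := by
      rw [hθ]
      gcongr
    have hx1 : 1 < ℓ / Real.log θ := by rwa [one_lt_div (by linarith)]
    set R := ⌈ℓ / Real.log θ⌉₊ with hR
    have hRge : ℓ / Real.log θ ≤ R := Nat.le_ceil _
    have hRlt : (R : ℝ) < ℓ / Real.log θ + 1 := Nat.ceil_lt_add_one (by linarith)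
    have hRpos : 0 < R := by
      have : (0 : ℝ) < R := by linarith
      exact_mod_cast this
    have hRlog : (R : ℝ) * Real.log θ < 2 * ℓ := by
      have h := mul_lt_mul_of_pos_right hRlt (by linarith : 0 < Real.log θ)
      rw [add_mul, div_mul_cancel₀ _ (by linarith : Real.log θ ≠ 0)] at h
      linarith
    have hεR : ε ^ 2 * θ ^ R < 1 := by
      have e : θ ^ R = Real.exp (R * Real.log θ) := by
        rw [Real.exp_nat_mul, Real.exp_log hθ0]
      rw [e, hεℓ, ← Real.exp_nat_mul, ← Real.exp_add, Real.exp_lt_one_iff]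
      push_cast
      linarith
    have hRL : (R : ℤ) ≤ 2 * ⌊L / 2⌋ + 1 := by
      have hfl := Int.lt_floor_add_one (L / 2)
      have hR2 : (R : ℝ) ≤ R * Real.log θ := le_mul_of_one_le_right (Nat.cast_nonneg _) hlogθ
      have : (R : ℝ) ≤ 2 * (⌊L / 2⌋ : ℝ) + 1 := by linarith
      exact_mod_cast this
    have hmain : (eigCount (n + 1) V Λ E ε : ℝ) * R ≤ 4 * Λ.card := by
      exact_mod_cast eigCount_mul_le hV' x₀ L hRpos hRL hθE hεR
    have hℓR : ℓ ≤ R * Real.log θ := (div_le_iff₀ (by linarith)).1 hRge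
    calc (eigCount (n + 1) V Λ E ε : ℝ) * ℓ
        ≤ eigCount (n + 1) V Λ E ε * (R * Real.log θ) := by gcongr
      _ = eigCount (n + 1) V Λ E ε * R * Real.log θ := by ring
      _ ≤ 4 * Λ.card * Real.log θ := by gcongr
      _ = 4 * Real.log θ * Λ.card := by ring
  · have hbot : (⨆ μ ∈ Set.Icc E (E + ε),
        Module.End.eigenspace (ham (n + 1) V Λ) (μ : ℂ)) = ⊥ := by
      simp only [iSup_eq_bot]
      intro μ hμ
      by_contra hne
      exact hev ⟨μ, hμ, Module.End.hasEigenvalue_iff.2 hne⟩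
    have h0 : eigCount (n + 1) V Λ E ε = 0 := by
      rw [eigCount, hbot, finrank_bot]
    rw [h0, Nat.cast_zero, zero_mul]
    exact mul_nonneg (mul_nonneg (by norm_num) hlogθ0) hc0
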